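/- There is a unique K-linear isomorphism Φ from the algebraic dual (V ⊗_A W₀)^* onto the space B_A(V₀, W) of A-balanced K-bilinear forms on V₀ × W such that Φ(u)(b·v, w) = u(v ⊗ (b·w)) for all u ∈ (V ⊗_A W₀)^*, b ∈ B, v ∈ V and w ∈ W. -/

import Mathlib

open scoped TensorProduct

/-- The space of `A`-balanced `K`-bilinear forms on `V × W`, i.e. `K`-bilinear maps
`S : V × W → K` satisfying `S (a • v) w = S v (a • w)` for all `a ∈ A`, `v ∈ V`, `w ∈ W`. -/
def balancedForms (K A V W : Type*) [Field K] [CommRing A] [Algebra K A]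
    [AddCommGroup V] [Module A V] [Module K V] [IsScalarTower K A V]
    [AddCommGroup W] [Module A W] [Module K W] [IsScalarTower K A W] :
    Submodule K (V →ₗ[K] W →ₗ[K] K) where
  carrier := {S | ∀ (a : A) (v : V) (w : W), S (a • v) w = S v (a • w)}
  add_mem' := by
    intro S T hS hT a v w
    simp [hS a v w, hT a v w]
  zero_mem' := by intro a v w; simp
  smul_mem' := by
    intro k S hS a v w
    simp [hS a v w]


section Helpers

variable {A V W : Type*} [CommRing A] [AddCommGroup V] [Module A V] [AddCommGroup W] [Module A W]

/-- `b • w` as an element of `B • W`. -/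
def inB {B : Ideal A} (b : A) (hb : b ∈ B) (w : W) : ↥(B • (⊤ : Submodule A W)) :=
  ⟨b • w, Submodule.smul_mem_smul hb Submodule.mem_top⟩

theorem exists_fix {B : Ideal A}
    (hB : ∀ b₁ ∈ B, ∀ b₂ ∈ B, ∃ c ∈ B, c * b₁ = b₁ ∧ c * b₂ = b₂)
    (x : ↥(B • (⊤ : Submodule A V))) : ∃ c ∈ B, c • x = x := by
  obtain ⟨x, hx⟩ := x
  suffices h : ∃ c ∈ B, c • x = x by
    obtain ⟨c, hc, h⟩ := h
    exact ⟨c, hc, Subtype.ext h⟩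
  induction hx using Submodule.smul_induction_on' with
  | smul b hb v _ =>
    obtain ⟨c, hc, h, -⟩ := hB b hb b hb
    exact ⟨c, hc, by rw [← mul_smul, h]⟩
  | add x hx y hy h1 h2 =>
    obtain ⟨c1, hc1, h1⟩ := h1
    obtain ⟨c2, hc2, h2⟩ := h2
    obtain ⟨c, hc, e1, e2⟩ := hB c1 hc1 c2 hc2
    refine ⟨c, hc, ?_⟩
    rw [smul_add]
    congr 1
    · rw [← h1, ← mul_smul, e1]
    · rw [← h2, ← mul_smul, e2]

theorem tmul_inB {B : Ideal A} (x : V) (c d : A) (hc : c ∈ B) (hd : d ∈ B)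
    (h1 : c • x = x) (h2 : d • x = x) (w : W) :
    x ⊗ₜ[A] inB c hc w = x ⊗ₜ[A] inB d hd w := by
  have e : d • inB c hc w = c • inB d hd w := Subtype.ext (smul_comm d c w)
  calc x ⊗ₜ[A] inB c hc w = (d • x) ⊗ₜ[A] inB c hc w := by rw [h2]
    _ = (c • x) ⊗ₜ[A] inB d hd w := by
      rw [TensorProduct.smul_tmul, e, ← TensorProduct.smul_tmul]
    _ = _ := by rw [h1]

theorem exists_map (V W : Type*) [AddCommGroup V] [Module A V] [AddCommGroup W] [Module A W]
    {B : Ideal A}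
    (hB : ∀ b₁ ∈ B, ∀ b₂ ∈ B, ∃ c ∈ B, c * b₁ = b₁ ∧ c * b₂ = b₂) :
    ∃ L : ↥(B • (⊤ : Submodule A V)) ⊗[A] W →ₗ[A] V ⊗[A] ↥(B • (⊤ : Submodule A W)),
      ∀ (x : ↥(B • (⊤ : Submodule A V))) (w : W) (c : A) (hc : c ∈ B), c • x = x →
        L (x ⊗ₜ w) = (x : V) ⊗ₜ inB c hc w := by
  choose f hf hfx using exists_fix (V := V) hB
  have key : ∀ (x : ↥(B • (⊤ : Submodule A V))) (w : W) (c : A) (hc : c ∈ B), c • x = x →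
      (x : V) ⊗ₜ[A] inB (f x) (hf x) w = (x : V) ⊗ₜ[A] inB c hc w := by
    intro x w c hc h
    exact tmul_inB _ _ _ _ _ (congrArg Subtype.val (hfx x)) (congrArg Subtype.val h) w
  refine ⟨TensorProduct.lift (LinearMap.mk₂ A
    (fun x w => (x : V) ⊗ₜ[A] inB (f x) (hf x) w) ?_ ?_ ?_ ?_), ?_⟩
  · intro x y w
    obtain ⟨c, hc, e1, e2⟩ := hB _ (hf x) _ (hf y)
    have h1 : c • x = x := by
      conv_lhs => rw [← hfx x]
      rw [← mul_smul, e1, hfx]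
    have h2 : c • y = y := by
      conv_lhs => rw [← hfx y]
      rw [← mul_smul, e2, hfx]
    rw [key x w c hc h1, key y w c hc h2, key (x + y) w c hc (by rw [smul_add, h1, h2])]
    exact TensorProduct.add_tmul _ _ _
  · intro a x w
    rw [key (a • x) w (f x) (hf x) (by rw [smul_comm, hfx])]
    rfl
  · intro x w w'
    rw [← TensorProduct.tmul_add]
    congr 1
    exact Subtype.ext (smul_add _ _ _)
  · intro a x w
    rw [← TensorProduct.tmul_smul]
    congr 1
    exact Subtype.ext (smul_comm _ _ _)
  · intro x w c hc h
    exact key x w c hc h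

theorem exists_equiv (V W : Type*) [AddCommGroup V] [Module A V] [AddCommGroup W] [Module A W]
    {B : Ideal A}
    (hB : ∀ b₁ ∈ B, ∀ b₂ ∈ B, ∃ c ∈ B, c * b₁ = b₁ ∧ c * b₂ = b₂) :
    ∃ L : ↥(B • (⊤ : Submodule A V)) ⊗[A] W ≃ₗ[A] V ⊗[A] ↥(B • (⊤ : Submodule A W)),
      ∀ (b : A) (hb : b ∈ B) (v : V) (w : W),
        L (inB b hb v ⊗ₜ w) = v ⊗ₜ inB b hb w := by
  obtain ⟨L, hL⟩ := exists_map V W hB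
  obtain ⟨M, hM⟩ := exists_map W V hB
  have LM : ∀ (x : ↥(B • (⊤ : Submodule A V))) (w : W),
      TensorProduct.comm A _ _ (M (TensorProduct.comm A _ _ (L (x ⊗ₜ w)))) = x ⊗ₜ w := by
    intro x w
    obtain ⟨c, hc, h⟩ := exists_fix hB x
    obtain ⟨d, hd, e, -⟩ := hB c hc c hc
    have hdx : d • (x : V) = x := by
      have h' : c • (x : V) = x := congrArg Subtype.val h
      rw [← h', ← mul_smul, e]
    rw [hL x w c hc h, TensorProduct.comm_tmul,
      hM _ _ d hd (Subtype.ext (by simp [inB, ← mul_smul, e])), TensorProduct.comm_tmul]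
    have : inB d hd (x : V) = x := Subtype.ext hdx
    rw [this]
    change x ⊗ₜ[A] (c • w) = _
    rw [← TensorProduct.smul_tmul, h]
  have ML : ∀ (v : V) (y : ↥(B • (⊤ : Submodule A W))),
      L (TensorProduct.comm A _ _ (M (y ⊗ₜ v))) = v ⊗ₜ y := by
    intro v y
    obtain ⟨c, hc, h⟩ := exists_fix hB y
    obtain ⟨d, hd, e, -⟩ := hB c hc c hc
    have hdx : d • (y : W) = y := by
      have h' : c • (y : W) = y := congrArg Subtype.val h
      rw [← h', ← mul_smul, e]
    rw [hM y v c hc h, TensorProduct.comm_tmul,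
      hL _ _ d hd (Subtype.ext (by simp [inB, ← mul_smul, e]))]
    have : inB d hd (y : W) = y := Subtype.ext hdx
    rw [this]
    change (c • v) ⊗ₜ[A] y = _
    rw [TensorProduct.smul_tmul, h]
  refine ⟨LinearEquiv.ofLinear L
    ((TensorProduct.comm A _ _).toLinearMap ∘ₗ M ∘ₗ (TensorProduct.comm A _ _).toLinearMap)
    (TensorProduct.ext' fun v y => ?_) (TensorProduct.ext' fun x w => ?_), ?_⟩
  · simpa using ML v y
  · simpa using LM x w
  · intro b hb v w
    obtain ⟨c, hc, e, -⟩ := hB b hb b hb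
    rw [LinearEquiv.ofLinear_apply,
      hL _ _ c hc (Subtype.ext (by simp [inB, ← mul_smul, e]))]
    change (b • v) ⊗ₜ[A] _ = _
    rw [TensorProduct.smul_tmul]
    congr 1
    exact Subtype.ext (by simp [inB, ← mul_smul, mul_comm b c, e])

end Helpers

section Dual

variable (K A V W : Type*) [Field K] [CommRing A] [Algebra K A]
    [AddCommGroup V] [Module A V] [Module K V] [IsScalarTower K A V]
    [AddCommGroup W] [Module A W] [Module K W] [IsScalarTower K A W]

theorem tmul_ksmul (k : K) (v : V) (w : W) : v ⊗ₜ[A] (k • w) = k • (v ⊗ₜ[A] w) := by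
  rw [← algebraMap_smul A k w, ← TensorProduct.smul_tmul, algebraMap_smul,
    TensorProduct.smul_tmul']

/-- The dual of the tensor product is the space of balanced forms. -/
noncomputable def dualEquiv : Module.Dual K (V ⊗[A] W) ≃ₗ[K] balancedForms K A V W where
  toFun u := ⟨LinearMap.mk₂ K (fun v w => u (v ⊗ₜ[A] w))
    (fun v v' w => by rw [TensorProduct.add_tmul, map_add])
    (fun k v w => by rw [← TensorProduct.smul_tmul', map_smul])
    (fun v w w' => by rw [TensorProduct.tmul_add, map_add])
    (fun k v w => by rw [tmul_ksmul, map_smul]),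
    fun a v w => by simp [TensorProduct.smul_tmul]⟩
  map_add' u u' := by ext; rfl
  map_smul' k u := by ext; rfl
  invFun S :=
    let F : V ⊗[A] W →+ K := TensorProduct.liftAddHom
      (AddMonoidHom.mk' (fun v => (S.1 v).toAddMonoidHom) (fun v v' => by ext; simp))
      (fun a v w => S.2 a v w)
    { F with
      map_smul' := by
        intro k t
        change F (k • t) = k • F t
        induction t with
        | zero => simp
        | add x y hx hy => rw [smul_add, map_add, hx, hy, map_add, smul_add]
        | tmul v w =>
          rw [TensorProduct.smul_tmul']
          change S.1 (k • v) w = k • S.1 v w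
          simp }
  left_inv u := by
    ext t
    induction t with
    | zero => simp
    | add x y hx hy => rw [map_add, hx, hy, map_add]
    | tmul v w => rfl
  right_inv S := by ext; rfl

end Dual

/-- Let `B` be an ideal of `A` such that for any `b₁, b₂ ∈ B` there exists `c ∈ B` with
`c * b₁ = b₁` and `c * b₂ = b₂`, and let `V₀ := B • V`, `W₀ := B • W`.  There is a unique
`K`-linear isomorphism `Φ` from the algebraic dual `(V ⊗[A] W₀)^*` onto the space
`B_A(V₀, W)` of `A`-balanced `K`-bilinear forms on `V₀ × W` such that
`Φ u (b • v, w) = u (v ⊗ (b • w))` for all `u`, `b ∈ B`, `v ∈ V` and `w ∈ W`. -/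
theorem statement10 (K A V W : Type*) [Field K] [CommRing A] [Algebra K A]
    [AddCommGroup V] [Module A V] [Module K V] [IsScalarTower K A V]
    [AddCommGroup W] [Module A W] [Module K W] [IsScalarTower K A W]
    (B : Ideal A)
    (hB : ∀ b₁ ∈ B, ∀ b₂ ∈ B, ∃ c ∈ B, c * b₁ = b₁ ∧ c * b₂ = b₂) :
    ∃! Φ : Module.Dual K (V ⊗[A] ↥(B • (⊤ : Submodule A W))) ≃ₗ[K]
        ↥(balancedForms K A ↥(B • (⊤ : Submodule A V)) W),
      ∀ (u : Module.Dual K (V ⊗[A] ↥(B • (⊤ : Submodule A W))))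
        (b : A) (hb : b ∈ B) (v : V) (w : W),
        (Φ u).val ⟨b • v, Submodule.smul_mem_smul hb Submodule.mem_top⟩ w =
          u (v ⊗ₜ[A]
            (⟨b • w, Submodule.smul_mem_smul hb Submodule.mem_top⟩ :
              ↥(B • (⊤ : Submodule A W)))) := by
  obtain ⟨L, hL⟩ := exists_equiv V W hB
  have hk : ∀ (k : K) t, L (k • t) = k • L t := by
    intro k t
    rw [← algebraMap_smul A k t, map_smul, algebraMap_smul]
  let LK : (↥(B • (⊤ : Submodule A V)) ⊗[A] W) ≃ₗ[K] V ⊗[A] ↥(B • (⊤ : Submodule A W)) :=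
    { L with map_smul' := hk }
  refine ⟨LK.dualMap.trans (dualEquiv K A _ W), ?_, ?_⟩
  · intro u b hb v w
    exact congrArg u (hL b hb v w)
  · intro Ψ hΨ
    apply LinearEquiv.ext
    intro u
    apply Subtype.ext
    apply LinearMap.ext
    rintro ⟨x, hx⟩
    induction hx using Submodule.smul_induction_on' with
    | smul b hb v _ =>
      ext w
      exact (hΨ u b hb v w).trans (congrArg u (hL b hb v w)).symm
    | add x hx y hy h1 h2 =>
      have := congrArg₂ (· + ·) h1 h2
      simp only [← map_add] at this
      exact this
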